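/- arXiv:1711.08871 — 2 statements merged into one kernel-verified Lean document; each statement's English description precedes it below -/
import Mathlib

section
/- Let a₁, a₃ ∈ A be selfadjoint with E(a₁) = 0, and set σ₁² := ‖E(a₁²)‖ > 0. Assume: for every c ∈ B with Im c positive and invertible and each i ∈ {1,3}, c − aᵢ is invertible in A and Gᵢ(c) := E((c − aᵢ)⁻¹) is invertible in B; write Fᵢ(c) = Gᵢ(c)⁻¹, h₁(c) = c − F₁(c); and assume Im F₃(c) ≥ Im c for all such c. Let b ∈ B be such that Im b − 4√2·σ₁·1 is positive and invertible, set Δ_b := {r ∈ B : Im r − (3/4)·Im b is positive and invertible}, and define T_b(r) := h₁(F₃(r) + r − b) + b for r ∈ Δ_b. Then T_b is well defined on Δ_b and maps Δ_b into Δ_b, T_b has a unique fixed point w₃(b) in Δ_b, and for every r ∈ Δ_b the iterates T_b^{∘n}(r) converge in norm to w₃(b). -/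
open Filter

/-- The "imaginary part" `Im c = (c - c*)/(2i)` of an element of a complex C*-algebra. -/
noncomputable def imc {A : Type*} [CStarAlgebra A] (c : A) : A :=
  ((2 : ℂ) * Complex.I)⁻¹ • (c - star c)

/-- The operator-valued reciprocal Cauchy transform `F(c) = (E((c - a)⁻¹))⁻¹`. -/
noncomputable def Fop {A : Type*} [CStarAlgebra A] (E : A →ₗ[ℂ] A) (a c : A) : A :=
  Ring.inverse (E (Ring.inverse (c - a)))

/-- The operator-valued `h`-transform `h(c) = c - F(c)`. -/
noncomputable def hop {A : Type*} [CStarAlgebra A] (E : A →ₗ[ℂ] A) (a c : A) : A :=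
  c - Fop E a c

/-- The operator-valued additive fixed point map `T_b(r) = h₁(F₃(r) + r - b) + b`. -/
noncomputable def Topadd {A : Type*} [CStarAlgebra A] (E : A →ₗ[ℂ] A)
    (a₁ a₃ b r : A) : A :=
  hop E a₁ (Fop E a₃ r + r - b) + b


/-- Conditional expectation onto `S`. -/
structure CondE {A : Type*} [CStarAlgebra A] [PartialOrder A] [StarOrderedRing A]
    (S : StarSubalgebra ℂ A) (E : A →ₗ[ℂ] A) : Prop where
  closed : IsClosed (S : Set A)
  range : ∀ x : A, E x ∈ S
  one : E 1 = 1
  pos : ∀ x : A, 0 ≤ x → 0 ≤ E x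
  bimod : ∀ b b' x : A, b ∈ S → b' ∈ S → E (b * x * b') = b * E x * b'

set_option linter.unusedSectionVars false

section aux
variable {A : Type*} [CStarAlgebra A] [PartialOrder A] [StarOrderedRing A]
  {S : StarSubalgebra ℂ A} {E : A →ₗ[ℂ] A}

theorem CondE.left (h : CondE S E) {s : A} (hs : s ∈ S) (x : A) : E (s * x) = s * E x := by
  simpa using h.bimod s 1 x hs (one_mem S)

theorem CondE.right (h : CondE S E) {s : A} (hs : s ∈ S) (x : A) : E (x * s) = E x * s := by
  simpa using h.bimod 1 s x (one_mem S) hs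

theorem CondE.self (h : CondE S E) {s : A} (hs : s ∈ S) : E s = s := by
  simpa [h.one] using h.left hs 1

theorem CondE.mono (h : CondE S E) {x y : A} (hxy : x ≤ y) : E x ≤ E y := by
  have := h.pos (y - x) (sub_nonneg.2 hxy)
  rw [map_sub] at this
  exact sub_nonneg.1 this

theorem CondE.star_sa (h : CondE S E) {x : A} (hx : IsSelfAdjoint x) : IsSelfAdjoint (E x) := by
  have h1 : (0 : A) ≤ algebraMap ℝ A ‖x‖ - x := sub_nonneg.2 hx.le_algebraMap_norm_self
  have h2 : (0 : A) ≤ algebraMap ℝ A ‖x‖ := algebraMap_nonneg A (norm_nonneg x)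
  have h3 := (IsSelfAdjoint.of_nonneg (h.pos _ h2)).sub (IsSelfAdjoint.of_nonneg (h.pos _ h1))
  rw [← map_sub] at h3
  simpa using h3

theorem CondE.star (h : CondE S E) (x : A) : E (star x) = star (E x) := by
  have h1 := h.star_sa (realPart x).2
  have h2 := h.star_sa (imaginaryPart x).2
  have h3 := realPart_add_I_smul_imaginaryPart x
  have e1 : E x = E (realPart x : A) + Complex.I • E (imaginaryPart x : A) := by
    rw [← map_smul, ← map_add, h3]
  have e2 : Star.star x = (realPart x : A) - Complex.I • (imaginaryPart x : A) := by
    conv_lhs => rw [← h3]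
    simp [star_add, star_smul, sub_eq_add_neg]
  rw [e1, e2, map_sub, map_smul, star_add, star_smul, h1.star_eq, h2.star_eq]
  simp [sub_eq_add_neg]

theorem inverse_mem (hS : IsClosed (S : Set A)) {x : A} (hx : x ∈ S) : Ring.inverse x ∈ S := by
  by_cases hu : IsUnit x
  · obtain ⟨u, hu'⟩ := (StarSubalgebra.coe_isUnit (hS := hS) (a := (⟨x, hx⟩ : S))).1 hu
    have h1 : x * ((u⁻¹ : Sˣ) : S) = 1 := by
      have := congrArg (Subtype.val) (u.mul_inv)
      rw [hu'] at this
      simpa using this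
    have h2 : Ring.inverse x = ((u⁻¹ : Sˣ) : S) := by
      have := Ring.inverse_mul_cancel x hu
      calc Ring.inverse x = Ring.inverse x * (x * ((u⁻¹ : Sˣ) : S)) := by rw [h1, mul_one]
        _ = _ := by rw [← mul_assoc, this, one_mul]
    rw [h2]; exact Subtype.coe_prop _
  · rw [Ring.inverse_non_unit _ hu]; exact zero_mem S

theorem imc_sub (x y : A) : imc (x - y) = imc x - imc y := by
  simp only [imc, star_sub, ← smul_sub]; congr 1; abel

theorem imc_add (x y : A) : imc (x + y) = imc x + imc y := by
  simp only [imc, star_add, ← smul_add]; congr 1; abel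

theorem imc_sa (x : A) : star (imc x) = imc x := by
  simp only [imc, star_smul, star_sub, star_star]
  rw [← neg_sub, smul_neg, ← neg_smul]
  congr 1
  simp [Complex.inv_I]

theorem imc_mem {x : A} (hx : x ∈ S) : imc x ∈ S :=
  S.smul_mem (sub_mem hx (star_mem hx)) _

theorem continuous_imc : Continuous (imc : A → A) := by
  unfold imc; fun_prop

/-- data of a reciprocal Cauchy transform -/
structure Dat (S : StarSubalgebra ℂ A) (E : A →ₗ[ℂ] A) (a c F Y Z : A) : Prop where
  cS : c ∈ S
  FS : F ∈ S
  EY : E Y = 1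
  EZ : E Z = 1
  hY : Y * (c - a) = F
  hZ : (c - a) * Z = F

theorem exists_dat (h : CondE S E) {a c : A} (hc : c ∈ S) (h1 : IsUnit (c - a))
    (h2 : IsUnit (E (Ring.inverse (c - a)))) : ∃ Y Z, Dat S E a c (Fop E a c) Y Z := by
  have FS : Fop E a c ∈ S := inverse_mem h.closed (h.range _)
  refine ⟨Fop E a c * Ring.inverse (c - a), Ring.inverse (c - a) * Fop E a c, hc, FS, ?_, ?_, ?_, ?_⟩
  · rw [h.left FS, Fop, Ring.inverse_mul_cancel _ h2]
  · rw [h.right FS, Fop, Ring.mul_inverse_cancel _ h2]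
  · rw [mul_assoc, Ring.inverse_mul_cancel _ h1, mul_one]
  · rw [← mul_assoc, Ring.mul_inverse_cancel _ h1, one_mul]

theorem Dat.im_left (h : CondE S E) {a c F Y Z : A} (ha : IsSelfAdjoint a) (d : Dat S E a c F Y Z) :
    imc F = E (Y * imc c * star Y) := by
  have e1 : E (Y * (c - a) * star Y) = F := by
    rw [d.hY, h.left d.FS, h.star, d.EY]; simp
  have e2 : E (Y * (star c - a) * star Y) = star F := by
    have : star (Y * (c - a) * star Y) = Y * (star c - a) * star Y := by
      simp [ha.star_eq, mul_assoc]
    rw [← this, h.star, e1]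
  have e3 : Y * imc c * star Y = ((2 : ℂ) * Complex.I)⁻¹ •
      (Y * (c - a) * star Y - Y * (star c - a) * star Y) := by
    simp only [imc, mul_smul_comm, smul_mul_assoc]; congr 1; noncomm_ring
  rw [e3, map_smul, map_sub, e1, e2, imc]

theorem Dat.im_right (h : CondE S E) {a c F Y Z : A} (ha : IsSelfAdjoint a) (d : Dat S E a c F Y Z) :
    imc F = E (star Z * imc c * Z) := by
  have e1 : E (star Z * (c - a) * Z) = F := by
    rw [mul_assoc, d.hZ, h.right d.FS, h.star, d.EZ]; simp
  have e2 : E (star Z * (star c - a) * Z) = star F := by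
    have : star (star Z * (c - a) * Z) = star Z * (star c - a) * Z := by
      simp [ha.star_eq, mul_assoc]
    rw [← this, h.star, e1]
  have e3 : star Z * imc c * Z = ((2 : ℂ) * Complex.I)⁻¹ •
      (star Z * (c - a) * Z - star Z * (star c - a) * Z) := by
    simp only [imc, mul_smul_comm, smul_mul_assoc]; congr 1; noncomm_ring
  rw [e3, map_smul, map_sub, e1, e2, imc]

theorem Dat.diff (h : CondE S E) {a x y F F' Y Z Y' Z' : A} (d : Dat S E a x F Y Z)
    (d' : Dat S E a y F' Y' Z') : E (Y * (x - y) * Z') = F - F' := by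
  have : Y * (x - y) * Z' = F * Z' - Y * F' := by
    rw [← d.hY, ← d'.hZ]; noncomm_ring
  rw [this, map_sub, h.left d.FS, h.right d'.FS, d'.EZ, d.EY, mul_one, one_mul]

theorem var_eq (h : CondE S E) {Y β : A} (hY : E Y = 1) (hβ : β ∈ S) :
    E ((Y - 1) * β * star (Y - 1)) = E (Y * β * star Y) - β := by
  have : (Y - 1) * β * star (Y - 1) = Y * β * star Y - Y * β - β * star Y + β := by
    rw [star_sub, star_one]; noncomm_ring
  rw [this, map_add, map_sub, map_sub, h.left hβ, h.right hβ, h.star, hY, h.self hβ]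
  simp

theorem var_eq' (h : CondE S E) {Z β : A} (hZ : E Z = 1) (hβ : β ∈ S) :
    E (star (Z - 1) * β * (Z - 1)) = E (star Z * β * Z) - β := by
  have := var_eq h (Y := star Z) (β := β) (by rw [h.star, hZ, star_one]) hβ
  simpa using this

/-- the gap estimates -/
theorem Dat.gap_left (h : CondE S E) {a c F Y Z β : A} (ha : IsSelfAdjoint a)
    (d : Dat S E a c F Y Z) (hβ : β ∈ S) (hβ0 : 0 ≤ β) :
    E (Y * (imc c - β) * star Y) ≤ imc F - β := by
  have := h.pos _ (star_right_conjugate_nonneg hβ0 (Y - 1))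
  rw [var_eq h d.EY hβ] at this
  rw [d.im_left h ha, mul_sub, sub_mul, map_sub]
  exact sub_le_sub_left (sub_nonneg.1 this) _

theorem Dat.gap_right (h : CondE S E) {a c F Y Z β : A} (ha : IsSelfAdjoint a)
    (d : Dat S E a c F Y Z) (hβ : β ∈ S) (hβ0 : 0 ≤ β) :
    E (star Z * (imc c - β) * Z) ≤ imc F - β := by
  have := h.pos _ (star_left_conjugate_nonneg hβ0 (Z - 1))
  rw [var_eq' h d.EZ hβ] at this
  rw [d.im_right h ha, mul_sub, sub_mul, map_sub]
  exact sub_le_sub_left (sub_nonneg.1 this) _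

/-- the bound on the imaginary part of `h₁` -/
theorem Dat.bound (h : CondE S E) {a c F Y Z : A} (ha : IsSelfAdjoint a) (hEa : E a = 0)
    (d : Dat S E a c F Y Z) {ε s : ℝ} (hε : 0 < ε) (hs : ‖E (a * a)‖ ≤ s)
    (hc : ε • (1 : A) ≤ imc c) : imc F - imc c ≤ (s / ε) • (1 : A) := by
  set W := Y - 1 with hW
  have EW : E W = 0 := by rw [hW, map_sub, d.EY, h.one, sub_self]
  have e1 : imc F - imc c = E (W * imc c * star W) := by
    rw [var_eq h d.EY (imc_mem d.cS), d.im_left h ha]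
  have e2 : ε • E (W * star W) ≤ imc F - imc c := by
    have := h.mono (star_right_conjugate_le_conjugate hc W)
    rw [← e1] at this
    simpa [LinearMap.map_smul_of_tower] using this
  have e3 : c - F = E (W * a) := by
    have : W * a = W * c - F + c - a := by
      rw [← d.hY, hW]; noncomm_ring
    rw [this, map_sub, map_add, map_sub, h.right d.cS, EW, h.self d.FS, h.self d.cS, hEa]
    abel_nf; simp
  have e4 : imc F - imc c = -imc (c - F) := by rw [imc_sub]; abel
  have e5 := h.pos _ (mul_star_self_nonneg (ε • W + Complex.I • a))
  have e6 : (ε • W + Complex.I • a) * star (ε • W + Complex.I • a) =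
      (ε^2) • (W * star W) + a * a - ε • (Complex.I • (W * a) - Complex.I • star (W * a)) := by
    simp only [star_add, star_smul, ha.star_eq, star_mul, star_trivial, add_mul, mul_add,
      smul_mul_assoc, mul_smul_comm, RCLike.star_def, Complex.conj_I, smul_sub]
    have i1 : Complex.I • Complex.I • (a * a) = -(a * a) := by rw [smul_smul]; simp
    simp only [neg_smul, smul_neg, smul_add, i1]
    rw [smul_comm Complex.I ε (W * a), smul_smul ε ε, pow_two]
    abel
  have e7 : Complex.I • E (W * a) - Complex.I • star (E (W * a)) = (2 : ℝ) • (imc F - imc c) := by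
    rw [e4, e3, imc, ← smul_sub]
    rw [smul_neg, ← Complex.coe_smul, smul_smul, ← neg_smul]
    congr 1
    simp
    ring
  rw [e6, map_sub, map_add, LinearMap.map_smul_of_tower, LinearMap.map_smul_of_tower, map_sub,
    map_smul, map_smul, h.star, e7] at e5
  have e8 : E (a * a) ≤ s • (1 : A) := by
    have hsa : IsSelfAdjoint (E (a * a)) := h.star_sa (by
      rw [IsSelfAdjoint, star_mul, ha.star_eq])
    refine hsa.le_algebraMap_norm_self.trans ?_
    rw [Algebra.algebraMap_eq_smul_one]
    exact smul_le_smul_of_nonneg_right hs zero_le_one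
  have e9 : ε • (imc F - imc c) ≤ s • (1 : A) := by
    have := smul_le_smul_of_nonneg_left e2 hε.le
    rw [smul_smul, ← pow_two] at this
    rw [← sub_nonneg]
    calc (0 : A) ≤ _ := e5
      _ ≤ ε • (imc F - imc c) + s • (1 : A) - ε • ((2 : ℝ) • (imc F - imc c)) := by gcongr
      _ = _ := by module
  have := smul_le_smul_of_nonneg_left e9 (inv_nonneg.2 hε.le)
  rw [smul_smul, smul_smul, inv_mul_cancel₀ hε.ne', one_smul] at this
  rwa [div_eq_inv_mul]

/-- block positivity -/
def BlockRel (p z q : A) : Prop :=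
  ∀ u v : A, u * z * v + star (u * z * v) ≤ u * p * star u + star v * q * v

theorem rel_of_inv {p z q : A} (hp : 0 ≤ p) (hu : IsUnit p) (h : star z * Ring.inverse p * z ≤ q) :
    BlockRel p z q := by
  intro u v
  set r := Ring.inverse p with hr
  have r1 : p * r = 1 := Ring.mul_inverse_cancel p hu
  have r2 : r * p = 1 := Ring.inverse_mul_cancel p hu
  have ps : star p = p := (IsSelfAdjoint.of_nonneg hp).star_eq
  have rs : star r = r := by
    have : star r * p = 1 := by rw [← ps, ← star_mul, r1, star_one]
    calc star r = star r * (p * r) := by rw [r1, mul_one]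
      _ = r := by rw [← mul_assoc, this, one_mul]
  have h1 := star_left_conjugate_nonneg hp (star u - r * z * v)
  have e : star (star u - r * z * v) * p * (star u - r * z * v) =
     u * p * star u + star v * (star z * r * z) * v - (u * z * v + star (u * z * v)) := by
    simp only [star_sub, star_mul, star_star, rs]
    have : (u - star v * (star z * r)) * p * (star u - r * z * v) =
      u * p * star u - u * (p * r) * z * v - star v * star z * (r * p) * star u
        + star v * star z * (r * p) * r * z * v := by noncomm_ring
    rw [this, r1, r2]
    noncomm_ring
  rw [e, sub_nonneg] at h1
  exact h1.trans (add_le_add_right (star_left_conjugate_le_conjugate h v) _)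

theorem rel_of_norm {p z q : A} {η : ℝ} (hη : 0 < η) (hz : ‖z‖ ≤ η) (hp : η • (1 : A) ≤ p)
    (hq : η • (1 : A) ≤ q) : BlockRel p z q := by
  intro u v
  have h1 := star_mul_self_nonneg (η • star u - z * v)
  have h2 : star z * z ≤ (η ^ 2) • (1 : A) := by
    refine CStarAlgebra.star_mul_le_algebraMap_norm_sq.trans ?_
    rw [Algebra.algebraMap_eq_smul_one]
    exact smul_le_smul_of_nonneg_right (by gcongr) zero_le_one
  have h3 := star_left_conjugate_le_conjugate h2 v
  have e : star (η • star u - z * v) * (η • star u - z * v) =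
      η • (u * (η • (1 : A)) * star u) - η • (u * z * v + star (u * z * v))
        + star v * (star z * z) * v := by
    simp only [star_sub, star_smul, star_star, star_mul, star_trivial, sub_mul, mul_sub,
      smul_mul_assoc, mul_smul_comm, smul_sub, smul_add, mul_one, mul_assoc]
    abel
  rw [e] at h1
  have h4 : star v * (η ^ 2 • (1 : A)) * v = η • (star v * (η • (1 : A)) * v) := by
    simp only [mul_smul_comm, smul_mul_assoc, smul_smul, pow_two]
  rw [h4] at h3
  have h5 : η • (u * z * v + star (u * z * v)) ≤
     η • (u * p * star u + star v * q * v) := by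
    have := smul_le_smul_of_nonneg_left (add_le_add (star_right_conjugate_le_conjugate hp u)
      (star_left_conjugate_le_conjugate hq v)) hη.le
    refine le_trans ?_ this
    rw [smul_add η (u * (η • (1 : A)) * star u), ← sub_nonneg]
    refine h1.trans ((add_le_add_right h3 _).trans_eq ?_)
    abel
  have := smul_le_smul_of_nonneg_left h5 (inv_nonneg.2 hη.le)
  simpa [smul_smul, inv_mul_cancel₀ hη.ne'] using this

theorem push (h : CondE S E) {a x y F F' Y Z Y' Z' β : A} (ha : IsSelfAdjoint a)
    (d : Dat S E a x F Y Z) (d' : Dat S E a y F' Y' Z') (hβ : β ∈ S) (hβ0 : 0 ≤ β) {κ : ℝ}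
    (hr : BlockRel (imc x - β) (κ • (x - y)) (imc y - β)) {u v : A} (hu : u ∈ S) (hv : v ∈ S) :
    u * (κ • (F - F')) * v + star (u * (κ • (F - F')) * v) ≤
      u * (imc F - β) * star u + star v * (imc F' - β) * v := by
  have h1 := h.mono (hr (u * Y) (Z' * v))
  have e1 : E (u * Y * (κ • (x - y)) * (Z' * v)) = u * (κ • (F - F')) * v := by
    rw [← d.diff h d', ← LinearMap.map_smul_of_tower, ← h.bimod _ _ _ hu hv]
    congr 1
    simp only [mul_smul_comm, smul_mul_assoc, mul_assoc]
  have e2 : E (u * Y * (imc x - β) * star (u * Y)) =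
      u * E (Y * (imc x - β) * star Y) * star u := by
    rw [← h.bimod _ _ _ hu (star_mem hu)]; congr 1; rw [star_mul]; noncomm_ring
  have e3 : E (star (Z' * v) * (imc y - β) * (Z' * v)) =
      star v * E (star Z' * (imc y - β) * Z') * v := by
    rw [← h.bimod _ _ _ (star_mem hv) hv]; congr 1; rw [star_mul]; noncomm_ring
  rw [map_add, map_add, h.star, e1, e2, e3] at h1
  exact h1.trans (add_le_add (star_right_conjugate_le_conjugate (d.gap_left h ha hβ hβ0) u)
    (star_left_conjugate_le_conjugate (d'.gap_right h ha hβ hβ0) v))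

theorem rel_of_tested (h : CondE S E) {p z q : A} (hp : 0 ≤ p) (hu : IsUnit p) (hpS : p ∈ S)
    (hzS : z ∈ S)
    (H : ∀ u v, u ∈ S → v ∈ S → u * z * v + star (u * z * v) ≤ u * p * star u + star v * q * v) :
    BlockRel p z q := by
  apply rel_of_inv hp hu
  set r := Ring.inverse p with hr
  have r1 : p * r = 1 := Ring.mul_inverse_cancel p hu
  have r2 : r * p = 1 := Ring.inverse_mul_cancel p hu
  have ps : star p = p := (IsSelfAdjoint.of_nonneg hp).star_eq
  have rs : star r = r := by
    have : star r * p = 1 := by rw [← ps, ← star_mul, r1, star_one]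
    calc star r = star r * (p * r) := by rw [r1, mul_one]
      _ = r := by rw [← mul_assoc, this, one_mul]
  have h1 := H (star z * r) 1 (mul_mem (star_mem hzS) (inverse_mem h.closed hpS)) (one_mem S)
  have e : star z * r * p * star (star z * r) = star z * r * z := by
    rw [mul_assoc (star z), r2, star_mul, rs, star_star, mul_one, mul_assoc]
  have e' : star (star z * r * z) = star z * r * z := by simp [rs, mul_assoc]
  rw [e, mul_one, star_one, one_mul, mul_one, e'] at h1
  exact le_of_add_le_add_left h1

theorem final_bound (h : CondE S E) {a x y F F' Y Z Y' Z' : A} (ha : IsSelfAdjoint a)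
    (d : Dat S E a x F Y Z) (d' : Dat S E a y F' Y' Z') {κ M : ℝ} (hκ : 0 < κ) (hM : 0 < M)
    (hr : BlockRel (imc x) (κ • (x - y)) (imc y))
    (hF : imc F - imc x ≤ M • (1 : A)) (hF' : imc F' - imc y ≤ M • (1 : A)) :
    ‖(x - F) - (y - F')‖ ≤ M / κ := by
  set D := (F - F') - (x - y) with hD
  have DS : D ∈ S := sub_mem (sub_mem d.FS d'.FS) (sub_mem d.cS d'.cS)
  have e0 : E ((Y - 1) * (x - y) * (Z' - 1)) = D := by
    have : (Y - 1) * (x - y) * (Z' - 1) =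
      Y * (x - y) * Z' - Y * (x - y) - (x - y) * Z' + (x - y) := by noncomm_ring
    have xS : x - y ∈ S := sub_mem d.cS d'.cS
    rw [this, map_add, map_sub, map_sub, d.diff h d', h.right xS, h.left xS, d.EY, d'.EZ,
      h.self xS, hD]
    simp
  set u := (κ / M) • star D with hu
  have uS : u ∈ S := by
    rw [hu, ← Complex.coe_smul]; exact S.smul_mem (star_mem DS) _
  have h1 := h.mono (hr (u * (Y - 1)) (Z' - 1))
  have e1 : E (u * (Y - 1) * (κ • (x - y)) * (Z' - 1)) = (κ ^ 2 / M) • (star D * D) := by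
    have : u * (Y - 1) * (κ • (x - y)) * (Z' - 1) =
       κ • (u * ((Y - 1) * (x - y) * (Z' - 1))) := by
      simp only [mul_smul_comm, smul_mul_assoc, mul_assoc]
    rw [this, LinearMap.map_smul_of_tower, h.left uS, e0, hu, smul_mul_assoc, smul_smul]
    congr 1; ring
  have e2 : E (u * (Y - 1) * imc x * star (u * (Y - 1))) ≤ (κ ^ 2 / M) • (star D * D) := by
    have : u * (Y - 1) * imc x * star (u * (Y - 1)) =
       u * ((Y - 1) * imc x * star (Y - 1)) * star u := by rw [star_mul]; noncomm_ring
    rw [this, h.bimod _ _ _ uS (star_mem uS), var_eq h d.EY (imc_mem d.cS), ← d.im_left h ha]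
    refine (star_right_conjugate_le_conjugate hF u).trans_eq ?_
    rw [hu]
    simp only [star_smul, star_star, star_trivial, mul_smul_comm, smul_mul_assoc, mul_one,
      smul_smul]
    congr 1; field_simp
  have e3 : E (star (Z' - 1) * imc y * (Z' - 1)) ≤ M • (1 : A) := by
    rw [var_eq' h d'.EZ (imc_mem d'.cS), ← d'.im_right h ha]; exact hF'
  have e4 : star ((κ ^ 2 / M) • (star D * D)) = (κ ^ 2 / M) • (star D * D) := by simp
  rw [map_add, map_add, h.star, e1, e4] at h1
  have h2 : (κ ^ 2 / M) • (star D * D) ≤ M • (1 : A) :=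
    le_of_add_le_add_left (h1.trans (add_le_add e2 e3))
  have h3 : star D * D ≤ algebraMap ℝ A ((M / κ) ^ 2) := by
    have := smul_le_smul_of_nonneg_left h2 (show 0 ≤ M / κ ^ 2 by positivity)
    rw [smul_smul, smul_smul] at this
    rw [Algebra.algebraMap_eq_smul_one]
    convert this using 2
    · rw [show M / κ ^ 2 * (κ ^ 2 / M) = 1 by field_simp, one_smul]
    · ring
  have h4 := (CStarAlgebra.norm_le_iff_le_algebraMap (star D * D) (by positivity)
    (star_mul_self_nonneg D)).2 h3
  rw [CStarRing.norm_star_mul_self, ← pow_two] at h4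
  have h5 := abs_le_of_sq_le_sq h4 (by positivity)
  rw [abs_of_nonneg (norm_nonneg D)] at h5
  have : (x - F) - (y - F') = -D := by rw [hD]; abel
  rwa [this, norm_neg]

theorem isUnit_of_smul_le {x : A} {ε : ℝ} (hε : 0 < ε) (h : ε • (1 : A) ≤ x) : IsUnit x := by
  refine CStarAlgebra.isUnit_of_le (ε • (1 : A)) h ?_
  refine IsStrictlyPositive.smul hε ?_
  exact isStrictlyPositive_one

theorem nonneg_of_smul_le {x : A} {ε : ℝ} (hε : 0 < ε) (h : ε • (1 : A) ≤ x) : 0 ≤ x :=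
  (smul_nonneg hε.le zero_le_one).trans h

end aux

/-- Operator-valued additive subordination fixed point: with `E a₁ = 0`,
`σ₁² = ‖E(a₁²)‖ > 0` and `b ∈ B` such that `Im b - 4√2·σ₁·1` is positive and invertible,
the map `T_b(r) = h₁(F₃(r) + r - b) + b` is well defined on
`Δ_b = {r ∈ B : Im r - (3/4)·Im b` positive and invertible`}`, maps `Δ_b` into itself,
has a unique fixed point `w₃(b)` there, and its iterates converge in norm to `w₃(b)`. -/
theorem operator_additive_deconvolution_fixed_point
    {A : Type*} [CStarAlgebra A] [PartialOrder A] [StarOrderedRing A]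
    (S : StarSubalgebra ℂ A) (hSclosed : IsClosed (S : Set A))
    (E : A →ₗ[ℂ] A)
    (hErange : ∀ x : A, E x ∈ S)
    (hEone : E 1 = 1)
    (hEpos : ∀ x : A, 0 ≤ x → 0 ≤ E x)
    (hEmod : ∀ b b' x : A, b ∈ S → b' ∈ S → E (b * x * b') = b * E x * b')
    (a₁ a₃ : A) (ha₁ : IsSelfAdjoint a₁) (ha₃ : IsSelfAdjoint a₃)
    (hEa₁ : E a₁ = 0)
    (σ₁ : ℝ) (hσ₁pos : 0 < σ₁) (hσ₁ : σ₁ ^ 2 = ‖E (a₁ * a₁)‖)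
    (hdom₁ : ∀ c : A, c ∈ S → 0 ≤ imc c → IsUnit (imc c) →
      IsUnit (c - a₁) ∧ IsUnit (E (Ring.inverse (c - a₁))))
    (hdom₃ : ∀ c : A, c ∈ S → 0 ≤ imc c → IsUnit (imc c) →
      IsUnit (c - a₃) ∧ IsUnit (E (Ring.inverse (c - a₃))))
    (hF₃im : ∀ c : A, c ∈ S → 0 ≤ imc c → IsUnit (imc c) → imc c ≤ imc (Fop E a₃ c))
    (b : A) (hb : b ∈ S)
    (hbpos : 0 ≤ imc b - ((4 * Real.sqrt 2 * σ₁ : ℝ) • (1 : A)))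
    (hbinv : IsUnit (imc b - ((4 * Real.sqrt 2 * σ₁ : ℝ) • (1 : A)))) :
    (∀ r : A, r ∈ S → 0 ≤ imc r - (3 / 4 : ℝ) • imc b →
      IsUnit (imc r - (3 / 4 : ℝ) • imc b) →
      ((Fop E a₃ r + r - b ∈ S ∧ 0 ≤ imc (Fop E a₃ r + r - b) ∧
          IsUnit (imc (Fop E a₃ r + r - b))) ∧
        (Topadd E a₁ a₃ b r ∈ S ∧
          0 ≤ imc (Topadd E a₁ a₃ b r) - (3 / 4 : ℝ) • imc b ∧
          IsUnit (imc (Topadd E a₁ a₃ b r) - (3 / 4 : ℝ) • imc b)))) ∧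
    ∃ w₃ : A,
      (w₃ ∈ S ∧ 0 ≤ imc w₃ - (3 / 4 : ℝ) • imc b ∧
        IsUnit (imc w₃ - (3 / 4 : ℝ) • imc b)) ∧
      Topadd E a₁ a₃ b w₃ = w₃ ∧
      (∀ r : A, r ∈ S → 0 ≤ imc r - (3 / 4 : ℝ) • imc b →
        IsUnit (imc r - (3 / 4 : ℝ) • imc b) → Topadd E a₁ a₃ b r = r → r = w₃) ∧
      (∀ r : A, r ∈ S → 0 ≤ imc r - (3 / 4 : ℝ) • imc b →
        IsUnit (imc r - (3 / 4 : ℝ) • imc b) →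
        Tendsto (fun n : ℕ => (Topadd E a₁ a₃ b)^[n] r) atTop (nhds w₃)) := by
  have h : CondE S E := ⟨hSclosed, hErange, hEone, hEpos, hEmod⟩
  have s2 : 0 < Real.sqrt 2 := by positivity
  have s22 : Real.sqrt 2 * Real.sqrt 2 = 2 := Real.mul_self_sqrt (by norm_num)
  obtain ⟨t, ht⟩ : ∃ t, t = Real.sqrt 2 * σ₁ := ⟨_, rfl⟩
  have htpos : 0 < t := by rw [ht]; positivity
  have htt : σ₁ ^ 2 = t * t / 2 := by rw [ht]; linear_combination (-σ₁ ^ 2 / 2) * s22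
  have hbt : (4 * t) • (1 : A) ≤ imc b := by
    rw [ht, ← mul_assoc]; exact sub_nonneg.1 hbpos
  have hbS : imc b ∈ S := imc_mem hb
  have hb0 : 0 ≤ imc b := nonneg_of_smul_le (by positivity) hbt
  have hβS : (3 / 4 : ℝ) • imc b ∈ S := by
    rw [← Complex.coe_smul]; exact S.smul_mem hbS _
  have hβ0 : 0 ≤ (3 / 4 : ℝ) • imc b := smul_nonneg (by norm_num) hb0
  have hscale : ∀ k : ℝ, 0 ≤ k → (k * (4 * t)) • (1 : A) ≤ k • imc b := by
    intro k hk
    rw [mul_smul]; exact smul_le_smul_of_nonneg_left hbt hk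
  -- the inner map
  have hr0 : ∀ r : A, 0 ≤ imc r - (3 / 4 : ℝ) • imc b → 0 ≤ imc r ∧ IsUnit (imc r) := by
    intro r hr
    have h1 := (hscale (3 / 4) (by norm_num)).trans (sub_nonneg.1 hr)
    exact ⟨nonneg_of_smul_le (by positivity) h1, isUnit_of_smul_le (by positivity) h1⟩
  have hPhi : ∀ r : A, r ∈ S → 0 ≤ imc r - (3 / 4 : ℝ) • imc b →
      Fop E a₃ r + r - b ∈ S ∧ (2 * t) • (1 : A) ≤ imc (Fop E a₃ r + r - b) := by
    intro r hrS hr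
    obtain ⟨r0, ru⟩ := hr0 r hr
    have hF := hF₃im r hrS r0 ru
    refine ⟨sub_mem (add_mem (inverse_mem hSclosed (hErange _)) hrS) hb, ?_⟩
    rw [imc_sub, imc_add]
    have h1 := sub_nonneg.1 hr
    calc (2 * t) • (1 : A) = ((1 / 2) * (4 * t)) • (1 : A) := by congr 1; ring
      _ ≤ (1 / 2 : ℝ) • imc b := hscale _ (by norm_num)
      _ = (3 / 4 : ℝ) • imc b + (3 / 4 : ℝ) • imc b - imc b := by module
      _ ≤ _ := sub_le_sub_right (add_le_add (h1.trans hF) h1) _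
  have hPhi2 : ∀ r : A, r ∈ S → 0 ≤ imc r - (3 / 4 : ℝ) • imc b →
      ∃ Y Z, Dat S E a₁ (Fop E a₃ r + r - b) (Fop E a₁ (Fop E a₃ r + r - b)) Y Z ∧
        imc (Fop E a₁ (Fop E a₃ r + r - b)) - imc (Fop E a₃ r + r - b) ≤ (t / 4) • (1 : A) := by
    intro r hrS hr
    obtain ⟨cS, hc⟩ := hPhi r hrS hr
    obtain ⟨k1, k2⟩ := hdom₁ _ cS (nonneg_of_smul_le (by positivity) hc)
      (isUnit_of_smul_le (by positivity) hc)
    obtain ⟨Y, Z, d⟩ := exists_dat h cS k1 k2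
    refine ⟨Y, Z, d, ?_⟩
    have := d.bound h ha₁ hEa₁ (show 0 < 2 * t by positivity) hσ₁.ge hc
    rwa [show σ₁ ^ 2 / (2 * t) = t / 4 by rw [htt]; field_simp; norm_num] at this
  have hT : ∀ r : A, r ∈ S → 0 ≤ imc r - (3 / 4 : ℝ) • imc b →
      Topadd E a₁ a₃ b r ∈ S ∧
      (3 / 4 * t) • (1 : A) ≤ imc (Topadd E a₁ a₃ b r) - (3 / 4 : ℝ) • imc b := by
    intro r hrS hr
    obtain ⟨Y, Z, d, hd⟩ := hPhi2 r hrS hr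
    unfold Topadd hop
    refine ⟨add_mem (sub_mem d.cS d.FS) hb, ?_⟩
    rw [imc_add, imc_sub]
    have h1 := hscale (1 / 4) (by norm_num)
    generalize imc (Fop E a₃ r + r - b) = p at hd ⊢
    generalize imc (Fop E a₁ (Fop E a₃ r + r - b)) = q at hd ⊢
    calc (3 / 4 * t) • (1 : A) = (1 / 4 * (4 * t)) • (1 : A) - (t / 4) • (1 : A) := by module
      _ ≤ (1 / 4 : ℝ) • imc b - (q - p) := sub_le_sub h1 hd
      _ = _ := by module
  have hLip : ∀ x y : A, x ∈ S → y ∈ S →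
      (3 / 4 * t) • (1 : A) ≤ imc x - (3 / 4 : ℝ) • imc b →
      (3 / 4 * t) • (1 : A) ≤ imc y - (3 / 4 : ℝ) • imc b →
      ‖Topadd E a₁ a₃ b x - Topadd E a₁ a₃ b y‖ ≤ (1 / 3) * ‖x - y‖ := by
    intro x y hxS hyS hx hy
    have hη : 0 < 3 / 4 * t := by positivity
    by_cases hxy : x = y
    · subst hxy; simp
    have hn : 0 < ‖x - y‖ := norm_pos_iff.2 (sub_ne_zero.2 hxy)
    have hx0 := nonneg_of_smul_le hη hx
    have hy0 := nonneg_of_smul_le hη hy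
    obtain ⟨κ, hκ⟩ : ∃ κ, κ = 3 / 4 * t / ‖x - y‖ := ⟨_, rfl⟩
    have hκ0 : 0 < κ := by rw [hκ]; positivity
    have hzn : ‖κ • (x - y)‖ ≤ 3 / 4 * t := by
      rw [norm_smul, Real.norm_of_nonneg hκ0.le, hκ, div_mul_cancel₀ _ hn.ne']
    have hrel := rel_of_norm hη hzn hx hy
    obtain ⟨k1, k2⟩ := hdom₃ x hxS (hr0 x hx0).1 (hr0 x hx0).2
    obtain ⟨Y, Z, d⟩ := exists_dat h hxS k1 k2
    obtain ⟨k1', k2'⟩ := hdom₃ y hyS (hr0 y hy0).1 (hr0 y hy0).2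
    obtain ⟨Y', Z', d'⟩ := exists_dat h hyS k1' k2'
    obtain ⟨cS, hc⟩ := hPhi x hxS hx0
    obtain ⟨cS', hc'⟩ := hPhi y hyS hy0
    have hrel2 : BlockRel (imc (Fop E a₃ x + x - b))
        (κ • ((Fop E a₃ x + x - b) - (Fop E a₃ y + y - b))) (imc (Fop E a₃ y + y - b)) := by
      apply rel_of_tested h (nonneg_of_smul_le (by positivity) hc)
        (isUnit_of_smul_le (by positivity) hc) (imc_mem cS)
      · rw [← Complex.coe_smul]; exact S.smul_mem (sub_mem cS cS') _
      intro u v hu hv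
      have p1 := push h ha₃ d d' hβS hβ0 hrel hu hv
      have p2 := hrel u v
      have p3 := add_le_add p1 p2
      have q1 : ∀ w : A, imc (Fop E a₃ w + w - b) =
          ((imc (Fop E a₃ w) - (3 / 4 : ℝ) • imc b) + (imc w - (3 / 4 : ℝ) • imc b))
            + (1 / 2 : ℝ) • imc b := by
        intro w; rw [imc_sub, imc_add]; module
      have q2 : 0 ≤ (1 / 2 : ℝ) • imc b := smul_nonneg (by norm_num) hb0
      have p4 := add_nonneg (star_right_conjugate_nonneg q2 u) (star_left_conjugate_nonneg q2 v)
      have q3 : κ • ((Fop E a₃ x + x - b) - (Fop E a₃ y + y - b)) =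
          κ • (Fop E a₃ x - Fop E a₃ y) + κ • (x - y) := by
        rw [← smul_add]; congr 1; abel
      rw [q1 x, q1 y, q3]
      have p5 := add_le_add p3 p4
      rw [add_zero] at p5
      refine le_trans (le_of_eq ?_) (p5.trans_eq ?_)
      · simp only [mul_add, add_mul, star_add]; abel
      · simp only [mul_add, add_mul]; abel
    obtain ⟨Y₁, Z₁, d₁, hd₁⟩ := hPhi2 x hxS hx0
    obtain ⟨Y₂, Z₂, d₂, hd₂⟩ := hPhi2 y hyS hy0
    have := final_bound h ha₁ d₁ d₂ hκ0 (show 0 < t / 4 by positivity) hrel2 hd₁ hd₂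
    unfold Topadd hop
    rw [add_sub_add_right_eq_sub]
    refine this.trans_eq ?_
    rw [hκ]; field_simp
  -- Banach fixed point theorem
  let K : Set A := {r | r ∈ S ∧ (3 / 4 * t) • (1 : A) ≤ imc r - (3 / 4 : ℝ) • imc b}
  have hη : 0 < 3 / 4 * t := by positivity
  have hKc : IsComplete K := by
    apply IsClosed.isComplete
    apply hSclosed.inter
    have : {r : A | (3 / 4 * t) • (1 : A) ≤ imc r - (3 / 4 : ℝ) • imc b} =
        (fun r => imc r - (3 / 4 : ℝ) • imc b - (3 / 4 * t) • (1 : A)) ⁻¹' {a : A | 0 ≤ a} := by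
      ext r; simp
    change IsClosed {r : A | (3 / 4 * t) • (1 : A) ≤ imc r - (3 / 4 : ℝ) • imc b}
    rw [this]
    exact CStarAlgebra.isClosed_nonneg.preimage
      ((continuous_imc.sub continuous_const).sub continuous_const)
  have hK0 : ∀ r ∈ K, 0 ≤ imc r - (3 / 4 : ℝ) • imc b := fun r hr => nonneg_of_smul_le hη hr.2
  have hmaps : Set.MapsTo (Topadd E a₁ a₃ b) K K := fun r hr => hT r hr.1 (hK0 r hr)
  have hcontr : ContractingWith (1 / 3) (hmaps.restrict (Topadd E a₁ a₃ b) K K) := by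
    refine ⟨by rw [← NNReal.coe_lt_coe]; norm_num, ?_⟩
    apply LipschitzWith.of_dist_le_mul
    rintro ⟨x, hx⟩ ⟨y, hy⟩
    have := hLip x y hx.1 hy.1 hx.2 hy.2
    simpa [Subtype.dist_eq, dist_eq_norm] using this
  have huniq : ∀ x y : A, x ∈ K → y ∈ K → Topadd E a₁ a₃ b x = x → Topadd E a₁ a₃ b y = y →
      x = y := by
    intro x y hx hy ex ey
    have := hLip x y hx.1 hy.1 hx.2 hy.2
    rw [ex, ey] at this
    have h0 : ‖x - y‖ = 0 := le_antisymm (by linarith) (norm_nonneg _)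
    exact sub_eq_zero.1 (norm_eq_zero.1 h0)
  have hban : ∀ x ∈ K, ∃ w ∈ K, Topadd E a₁ a₃ b w = w ∧
      Tendsto (fun n : ℕ => (Topadd E a₁ a₃ b)^[n] x) atTop (nhds w) := by
    intro x hx
    obtain ⟨w, hw, hfix, hlim, -⟩ := hcontr.exists_fixedPoint' hKc hmaps hx (edist_ne_top _ _)
    exact ⟨w, hw, hfix, hlim⟩
  have hTK : ∀ r : A, r ∈ S → 0 ≤ imc r - (3 / 4 : ℝ) • imc b → Topadd E a₁ a₃ b r ∈ K :=
    fun r hrS hr => hT r hrS hr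
  refine ⟨?_, ?_⟩
  · intro r hrS hr _
    obtain ⟨cS, hc⟩ := hPhi r hrS hr
    obtain ⟨TS, hTr⟩ := hT r hrS hr
    have h2t : 0 < 2 * t := by positivity
    exact ⟨⟨cS, nonneg_of_smul_le h2t hc, isUnit_of_smul_le h2t hc⟩,
      TS, nonneg_of_smul_le hη hTr, isUnit_of_smul_le hη hTr⟩
  · have hbK : 0 ≤ imc b - (3 / 4 : ℝ) • imc b := by
      have : imc b - (3 / 4 : ℝ) • imc b = (1 / 4 : ℝ) • imc b := by module
      rw [this]; exact smul_nonneg (by norm_num) hb0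
    obtain ⟨w, hw, hfix, -⟩ := hban _ (hTK b hb hbK)
    refine ⟨w, ⟨hw.1, nonneg_of_smul_le hη hw.2, isUnit_of_smul_le hη hw.2⟩, hfix, ?_, ?_⟩
    · intro r hrS hr _ hrfix
      refine huniq r w ?_ hw hrfix hfix
      rw [← hrfix]; exact hTK r hrS hr
    · intro r hrS hr _
      obtain ⟨w', hw', hfix', hlim⟩ := hban _ (hTK r hrS hr)
      rw [huniq w w' hw hw' hfix hfix']
      rw [← tendsto_add_atTop_iff_nat 1]
      simpa [Function.iterate_succ_apply] using hlim
end

section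
/- Let a ∈ A with a ≥ 0 and ‖a‖ ≤ R₁, suppose E(a) is invertible with spectrum contained in [α*, ∞) for some α* > 0, and set σ² := ‖E(a²) − E(a)²‖ and K₁ := R₁ + 2σ²/α*. Let κ ∈ (0,1) and let b ∈ B be invertible with ‖b‖ < κ/K₁ and Im(b⁻¹) positive and invertible; assume b⁻¹ − a is invertible in A and G(b⁻¹) := E((b⁻¹ − a)⁻¹) is invertible in B, and set H(b) := b⁻¹ − G(b⁻¹)⁻¹. Then H(b) is invertible in B and ‖H(b)⁻¹‖ ≤ 2/((2 − κ)·α*). -/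
open Filter

section helpers
variable {A : Type*} [CStarAlgebra A] [PartialOrder A] [StarOrderedRing A]

/-- Positive maps are star-preserving. -/
lemma aux_star (E : A →ₗ[ℂ] A) (hEpos : ∀ x : A, 0 ≤ x → 0 ≤ E x) (x : A) :
    E (star x) = star (E x) := by
  let P : A →ₚ[ℂ] A := PositiveLinearMap.mk₀ E hEpos
  exact map_star P x

lemma aux_cs (S : StarSubalgebra ℂ A) (E : A →ₗ[ℂ] A)
    (hErange : ∀ x : A, E x ∈ S)
    (hEpos : ∀ x : A, 0 ≤ x → 0 ≤ E x)
    (hEmod : ∀ b b' x : A, b ∈ S → b' ∈ S → E (b * x * b') = b * E x * b')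
    (x y : A) (N : ℝ) (hN : 0 < N) (hx : ‖E (star x * x)‖ ≤ N) :
    ‖E (star x * y)‖ ^ 2 ≤ N * ‖E (star y * y)‖ := by
  set d := E (star x * y) with hd
  have hdS : d ∈ S := hErange _
  have hdS' : star d ∈ S := star_mem hdS
  have one : (1 : A) ∈ S := one_mem S
  have h1 : E (star y * x) = star d := by
    rw [hd, ← aux_star E hEpos]; simp
  have h2 : 0 ≤ E (star ((N : ℂ) • y - x * d) * ((N : ℂ) • y - x * d)) :=
    hEpos _ (star_mul_self_nonneg _)
  have e1 : E (star y * x * d) = star d * d := by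
    have := hEmod 1 d (star y * x) one hdS
    simpa [h1] using this
  have e2 : E (star d * (star x * y)) = star d * d := by
    have := hEmod (star d) 1 (star x * y) hdS' one
    simpa [← hd] using this
  have e3 : E (star d * (star x * x) * d) = star d * E (star x * x) * d :=
    hEmod _ _ _ hdS' hdS
  have h3 : E (star ((N : ℂ) • y - x * d) * ((N : ℂ) • y - x * d))
      = ((N : ℂ) * N) • E (star y * y) - (2 * N : ℂ) • (star d * d)
        + star d * E (star x * x) * d := by
    have : star ((N : ℂ) • y - x * d) * ((N : ℂ) • y - x * d)
       = ((N : ℂ) * N) • (star y * y) - (N : ℂ) • (star y * x * d)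
         - (N : ℂ) • (star d * (star x * y)) + star d * (star x * x) * d := by
      simp only [star_sub, star_smul, star_mul, Complex.star_def, Complex.conj_ofReal, sub_mul, mul_sub, smul_mul_assoc,
        mul_smul_comm, mul_assoc, smul_sub, mul_smul]
      abel
    rw [this, map_add, map_sub, map_sub, map_smul, map_smul, map_smul, e1, e2, e3, two_mul,
      add_smul]
    abel
  have h4 : star d * E (star x * x) * d ≤ N • (star d * d) := by
    have hpos : 0 ≤ E (star x * x) := hEpos _ (star_mul_self_nonneg _)
    have hle : E (star x * x) ≤ algebraMap ℝ A N :=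
      (IsSelfAdjoint.le_algebraMap_norm_self (IsSelfAdjoint.of_nonneg hpos)).trans
        (algebraMap_mono A hx)
    have := star_left_conjugate_le_conjugate hle d
    simpa [Algebra.algebraMap_eq_smul_one] using this
  have h5 : N • (star d * d) ≤ (N * N) • E (star y * y) := by
    rw [h3] at h2
    have h6 : (0:A) ≤ (N * N) • E (star y * y) - (2 * N) • (star d * d) + N • (star d * d) := by
      refine h2.trans ?_
      gcongr
      · refine le_of_eq ?_
        rw [← Complex.coe_smul]
        push_cast
        rfl
      · refine le_of_eq ?_
        rw [← Complex.coe_smul (2 * N)]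
        push_cast
        rfl
    have : (N * N) • E (star y * y) - (2 * N) • (star d * d) + N • (star d * d)
        = (N * N) • E (star y * y) - N • (star d * d) := by
      rw [two_mul, add_smul]; abel
    rw [this] at h6
    exact sub_nonneg.mp h6
  have h7 := CStarAlgebra.norm_le_norm_of_nonneg_of_le (smul_nonneg hN.le (star_mul_self_nonneg d)) h5
  rw [norm_smul, norm_smul, CStarRing.norm_star_mul_self, Real.norm_of_nonneg hN.le,
    Real.norm_of_nonneg (by positivity), mul_assoc] at h7
  have := le_of_mul_le_mul_left h7 hN
  rw [sq]; exact this

/-- The seminorm of the conditional expectation. -/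
noncomputable def pE (E : A →ₗ[ℂ] A) (x : A) : ℝ := √‖E (star x * x)‖

lemma pE_sq (E : A →ₗ[ℂ] A) (x : A) : pE E x ^ 2 = ‖E (star x * x)‖ :=
  Real.sq_sqrt (norm_nonneg _)

lemma pE_nonneg (E : A →ₗ[ℂ] A) (x : A) : 0 ≤ pE E x := Real.sqrt_nonneg _

lemma aux_cs' (S : StarSubalgebra ℂ A) (E : A →ₗ[ℂ] A)
    (hErange : ∀ x : A, E x ∈ S)
    (hEpos : ∀ x : A, 0 ≤ x → 0 ≤ E x)
    (hEmod : ∀ b b' x : A, b ∈ S → b' ∈ S → E (b * x * b') = b * E x * b')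
    (x y : A) : ‖E (star x * y)‖ ≤ pE E x * pE E y := by
  apply le_of_sq_le_sq _ (mul_nonneg (pE_nonneg _ _) (pE_nonneg _ _))
  rw [mul_pow, pE_sq, pE_sq]
  have key : ∀ ε : ℝ, 0 < ε →
      ‖E (star x * y)‖ ^ 2 ≤ (‖E (star x * x)‖ + ε) * ‖E (star y * y)‖ := fun ε hε =>
    aux_cs S E hErange hEpos hEmod x y _ (by positivity) (by linarith)
  have hc : Tendsto (fun ε : ℝ => (‖E (star x * x)‖ + ε) * ‖E (star y * y)‖)
      (nhdsWithin 0 (Set.Ioi 0)) (nhds ((‖E (star x * x)‖ + 0) * ‖E (star y * y)‖)) := by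
    apply Tendsto.mono_left _ nhdsWithin_le_nhds
    exact Continuous.tendsto (by fun_prop) _
  rw [add_zero] at hc
  exact ge_of_tendsto hc (by filter_upwards [self_mem_nhdsWithin] with ε hε using key ε hε)

lemma pE_add (S : StarSubalgebra ℂ A) (E : A →ₗ[ℂ] A)
    (hErange : ∀ x : A, E x ∈ S)
    (hEpos : ∀ x : A, 0 ≤ x → 0 ≤ E x)
    (hEmod : ∀ b b' x : A, b ∈ S → b' ∈ S → E (b * x * b') = b * E x * b')
    (x y : A) : pE E (x + y) ≤ pE E x + pE E y := by
  apply le_of_sq_le_sq _ (add_nonneg (pE_nonneg _ _) (pE_nonneg _ _))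
  rw [pE_sq]
  have : star (x + y) * (x + y) = star x * x + star x * y + star y * x + star y * y := by
    rw [star_add]; noncomm_ring
  rw [this, map_add, map_add, map_add]
  have h1 := aux_cs' S E hErange hEpos hEmod x y
  have h2 := aux_cs' S E hErange hEpos hEmod y x
  have h3 := pE_sq E x
  have h4 := pE_sq E y
  have h5 := norm_add₄_le (a := E (star x * x)) (b := E (star x * y)) (c := E (star y * x))
    (d := E (star y * y))
  nlinarith

lemma pE_mul (E : A →ₗ[ℂ] A) (hEpos : ∀ x : A, 0 ≤ x → 0 ≤ E x) (c x : A) :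
    pE E (c * x) ≤ ‖c‖ * pE E x := by
  apply le_of_sq_le_sq _ (mul_nonneg (norm_nonneg _) (pE_nonneg _ _))
  rw [mul_pow, pE_sq, pE_sq]
  have hle : star c * c ≤ algebraMap ℝ A (‖c‖ ^ 2) := by
    have := IsSelfAdjoint.le_algebraMap_norm_self (IsSelfAdjoint.star_mul_self c)
    rwa [CStarRing.norm_star_mul_self, ← sq] at this
  have h := star_left_conjugate_le_conjugate hle x
  have h' : star (c * x) * (c * x) ≤ (‖c‖ ^ 2 : ℝ) • (star x * x) := by
    simpa [Algebra.algebraMap_eq_smul_one, mul_assoc] using h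
  have h2 := hEpos _ (sub_nonneg.mpr h')
  rw [map_sub, sub_nonneg, ← Complex.coe_smul, map_smul, Complex.coe_smul] at h2
  have h7 := CStarAlgebra.norm_le_norm_of_nonneg_of_le (hEpos _ (star_mul_self_nonneg (c * x))) h2
  rwa [norm_smul, Real.norm_of_nonneg (by positivity)] at h7

lemma aux_var (S : StarSubalgebra ℂ A) (E : A →ₗ[ℂ] A)
    (hErange : ∀ x : A, E x ∈ S) (hEone : E 1 = 1)
    (hEpos : ∀ x : A, 0 ≤ x → 0 ≤ E x)
    (hEmod : ∀ b b' x : A, b ∈ S → b' ∈ S → E (b * x * b') = b * E x * b') (x : A) :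
    E (star (x - E x) * (x - E x)) = E (star x * x) - star (E x) * E x := by
  have one : (1 : A) ∈ S := one_mem S
  have hs : star (E x) ∈ S := star_mem (hErange x)
  have e1 := hEmod (star (E x)) 1 x hs one
  have e2 := hEmod 1 (E x) (star x) one (hErange x)
  have e3 := hEmod (star (E x)) (E x) 1 hs (hErange x)
  simp only [mul_one, one_mul, hEone, aux_star E hEpos] at e1 e2 e3
  have : star (x - E x) * (x - E x)
      = star x * x - star x * E x - star (E x) * x + star (E x) * E x := by
    rw [star_sub]; noncomm_ring
  rw [this, map_add, map_sub, map_sub, e1, e2, e3]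
  abel

lemma pE_Q (S : StarSubalgebra ℂ A) (E : A →ₗ[ℂ] A)
    (hErange : ∀ x : A, E x ∈ S) (hEone : E 1 = 1)
    (hEpos : ∀ x : A, 0 ≤ x → 0 ≤ E x)
    (hEmod : ∀ b b' x : A, b ∈ S → b' ∈ S → E (b * x * b') = b * E x * b') (x : A) :
    pE E (x - E x) ≤ pE E x := by
  apply Real.sqrt_le_sqrt
  apply CStarAlgebra.norm_le_norm_of_nonneg_of_le (hEpos _ (star_mul_self_nonneg _))
  rw [aux_var S E hErange hEone hEpos hEmod]
  exact sub_le_self _ (star_mul_self_nonneg _)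

lemma aux_inv_norm (x : A) (hx : 0 ≤ x) (α : ℝ) (hα : 0 < α)
    (hspec : spectrum ℝ x ⊆ Set.Ici α) (hu : IsUnit x) : ‖Ring.inverse x‖ ≤ 1 / α := by
  have hsa : IsSelfAdjoint x := IsSelfAdjoint.of_nonneg hx
  obtain ⟨u, rfl⟩ := hu
  rw [Ring.inverse_unit, ← cfc_inv_id (R := ℝ) u hsa]
  apply norm_cfc_le (by positivity)
  intro t ht
  have h1 : α ≤ t := hspec ht
  rw [norm_inv, Real.norm_of_nonneg (hα.le.trans h1), one_div]
  exact inv_anti₀ hα h1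

end helpers

/-- Let `a ≥ 0` with `‖a‖ ≤ R₁`, `E a` invertible with spectrum in
`[α*, ∞)`, `σ² = ‖E(a²) - E(a)²‖`, `K₁ = R₁ + 2σ²/α*`. For `κ ∈ (0,1)` and `b ∈ B`
invertible with `‖b‖ < κ/K₁`, `Im(b⁻¹)` positive and invertible, `b⁻¹ - a` invertible in
`A` and `G(b⁻¹)` invertible in `B`, the element `H(b) = b⁻¹ - G(b⁻¹)⁻¹` is invertible
with `‖H(b)⁻¹‖ ≤ 2/((2 - κ)·α*)`. -/
theorem operator_H_inverse_bound
    {A : Type*} [CStarAlgebra A] [PartialOrder A] [StarOrderedRing A]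
    (S : StarSubalgebra ℂ A) (hSclosed : IsClosed (S : Set A))
    (E : A →ₗ[ℂ] A)
    (hErange : ∀ x : A, E x ∈ S)
    (hEone : E 1 = 1)
    (hEpos : ∀ x : A, 0 ≤ x → 0 ≤ E x)
    (hEmod : ∀ b b' x : A, b ∈ S → b' ∈ S → E (b * x * b') = b * E x * b')
    (a : A) (hapos : 0 ≤ a)
    (R₁ : ℝ) (haR₁ : ‖a‖ ≤ R₁)
    (hEaunit : IsUnit (E a))
    (αs : ℝ) (hαs : 0 < αs) (hspec : spectrum ℝ (E a) ⊆ Set.Ici αs)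
    (σ2 K₁ : ℝ) (hσ2 : σ2 = ‖E (a * a) - E a * E a‖) (hK₁ : K₁ = R₁ + 2 * σ2 / αs)
    (κ : ℝ) (hκ0 : 0 < κ) (hκ1 : κ < 1)
    (b : A) (hb : b ∈ S) (hbunit : IsUnit b) (hbnorm : ‖b‖ < κ / K₁)
    (hbpos : 0 ≤ imc (Ring.inverse b)) (hbinv : IsUnit (imc (Ring.inverse b)))
    (hba : IsUnit (Ring.inverse b - a))
    (hG : ∃ c ∈ S, E (Ring.inverse (Ring.inverse b - a)) * c = 1 ∧
      c * E (Ring.inverse (Ring.inverse b - a)) = 1) :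
    IsUnit (Ring.inverse b - Ring.inverse (E (Ring.inverse (Ring.inverse b - a)))) ∧
      ‖Ring.inverse
          (Ring.inverse b - Ring.inverse (E (Ring.inverse (Ring.inverse b - a))))‖ ≤
        2 / ((2 - κ) * αs) := by
  have hK0 : 0 < K₁ := by
    by_contra h
    have : κ / K₁ ≤ 0 := div_nonpos_of_nonneg_of_nonpos hκ0.le (not_lt.mp h)
    linarith [norm_nonneg b]
  have one : (1 : A) ∈ S := one_mem S
  have hasa : star a = a := (IsSelfAdjoint.of_nonneg hapos).star_eq
  have hEasa : star (E a) = E a := (IsSelfAdjoint.of_nonneg (hEpos a hapos)).star_eq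
  obtain ⟨c, hcS, hc1, hc2⟩ := hG
  set z := Ring.inverse b with hz
  set w := Ring.inverse (z - a) with hw
  have hGinv : Ring.inverse (E w) = c := by
    have hu : IsUnit (E w) := ⟨⟨E w, c, hc1, hc2⟩, rfl⟩
    calc Ring.inverse (E w) = Ring.inverse (E w) * (E w * c) := by rw [hc1, mul_one]
      _ = c := by rw [← mul_assoc, Ring.inverse_mul_cancel _ hu, one_mul]
  rw [hGinv]
  have hbz : b * z = 1 := Ring.mul_inverse_cancel b hbunit
  have hzw : (z - a) * w = 1 := Ring.mul_inverse_cancel _ hba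
  set y := w * c - 1 with hy
  have hEy : E y = 0 := by
    have := hEmod 1 c w one hcS
    simp only [one_mul] at this
    rw [hy, map_sub, this, hc1, hEone, sub_self]
  have hH : z - c = a + a * y - z * y := by
    have : (z - a) * (1 + y) = c := by
      rw [hy, add_sub_cancel, ← mul_assoc, hzw, one_mul]
    rw [← this]; noncomm_ring
  have hy2 : y = b * (a + a * y) - b * (z - c) := by
    rw [hH, ← mul_sub, sub_sub_cancel, ← mul_assoc, hbz, one_mul]
  have hby : b * (z - c) = b * E (a + a * y) := by
    have h1 := congrArg E hy2
    have h2 := hEmod b 1 (a + a * y) hb one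
    have h3 := hEmod b (z - c) 1 hb
    have hbzc : b * (z - c) ∈ S := by
      rw [mul_sub, hbz]; exact sub_mem one (mul_mem hb hcS)
    have h4 := hEmod (b * (z - c)) 1 1 hbzc one
    simp only [mul_one, hEone] at h2 h4
    rw [hEy, map_sub, h2, h4] at h1
    exact (sub_eq_zero.mp h1.symm).symm
  have hHE : z - c = E a + E (a * y) := by
    have hzb : z * b = 1 := Ring.inverse_mul_cancel b hbunit
    have := congrArg (z * ·) hby
    simpa [← mul_assoc, hzb] using this
  have hy3 : y = b * ((a - E a) + (a * y - E (a * y))) := by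
    have : (a - E a) + (a * y - E (a * y)) = (a + a * y) - E (a + a * y) := by
      rw [map_add]; abel
    rw [this, mul_sub, ← hby]
    exact hy2
  set s := pE E (a - E a) with hs
  have hs0 : 0 ≤ s := pE_nonneg _ _
  have hssq : s ^ 2 = σ2 := by
    rw [hs, pE_sq, aux_var S E hErange hEone hEpos hEmod, hasa, hEasa, hσ2]
  have hp0 : 0 ≤ pE E y := pE_nonneg _ _
  have hpy : pE E y ≤ ‖b‖ * (s + R₁ * pE E y) := by
    have h1 : pE E y ≤ ‖b‖ * pE E ((a - E a) + (a * y - E (a * y))) := by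
      conv_lhs => rw [hy3]
      exact pE_mul E hEpos _ _
    refine h1.trans (mul_le_mul_of_nonneg_left ?_ (norm_nonneg _))
    refine (pE_add S E hErange hEpos hEmod _ _).trans (add_le_add le_rfl ?_)
    refine (pE_Q S E hErange hEone hEpos hEmod _).trans ((pE_mul E hEpos _ _).trans ?_)
    exact mul_le_mul_of_nonneg_right haR₁ hp0
  have hD : ‖E (a * y)‖ ≤ s * pE E y := by
    have h1 : E (a * y) = E (star (a - E a) * y) := by
      have := hEmod (E a) 1 y (hErange a) one
      simp only [mul_one] at this
      rw [star_sub, hasa, hEasa, sub_mul, map_sub, this, hEy, mul_zero, sub_zero]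
    rw [h1]
    exact aux_cs' S E hErange hEpos hEmod _ _
  have hR0 : 0 ≤ R₁ := (norm_nonneg a).trans haR₁
  have hbK : ‖b‖ * R₁ * αs + 2 * ‖b‖ * σ2 ≤ κ * αs := by
    have h1 : ‖b‖ * K₁ < κ := (lt_div_iff₀ hK0).mp hbnorm
    have h2 : K₁ * αs = R₁ * αs + 2 * σ2 := by
      rw [hK₁]; field_simp
    have h3 := mul_le_mul_of_nonneg_right h1.le hαs.le
    rw [mul_assoc, h2] at h3
    linarith
  have hσ0 : 0 ≤ σ2 := by rw [hσ2]; exact norm_nonneg _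
  have hbR0 : 0 ≤ ‖b‖ * R₁ := mul_nonneg (norm_nonneg _) hR0
  have hbR : ‖b‖ * R₁ ≤ κ := by
    have : ‖b‖ * R₁ * αs ≤ κ * αs := by
      nlinarith [mul_nonneg (norm_nonneg b) hσ0]
    exact le_of_mul_le_mul_right this hαs
  have hDb : ‖E (a * y)‖ ≤ κ * αs / 2 := by
    have h1 : (1 - ‖b‖ * R₁) * (s * pE E y) ≤ ‖b‖ * σ2 := by
      rw [← hssq]; nlinarith [mul_le_mul_of_nonneg_left hpy hs0]
    have h2 : ‖b‖ * σ2 ≤ (1 - ‖b‖ * R₁) * (κ * αs / 2) := by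
      have : ‖b‖ * R₁ * αs * κ ≤ ‖b‖ * R₁ * αs :=
        mul_le_of_le_one_right (mul_nonneg hbR0 hαs.le) hκ1.le
      nlinarith
    exact hD.trans (le_of_mul_le_mul_left (h1.trans h2) (by linarith))
  rw [hHE]
  have hinv := aux_inv_norm (E a) (hEpos a hapos) αs hαs hspec hEaunit
  set D := E (a * y) with hDdef
  set e := E a with he
  set f := Ring.inverse e with hf
  have hef : e * f = 1 := Ring.mul_inverse_cancel _ hEaunit
  have hfe : f * e = 1 := Ring.inverse_mul_cancel _ hEaunit
  have hfD : ‖f * D‖ ≤ κ / 2 := by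
    calc ‖f * D‖ ≤ ‖f‖ * ‖D‖ := norm_mul_le _ _
      _ ≤ (1 / αs) * (κ * αs / 2) := by gcongr
      _ = κ / 2 := by field_simp
  have hunit : IsUnit (e + D) := by
    have h1 : IsUnit (1 - -(f * D)) := isUnit_one_sub_of_norm_lt_one (by rw [norm_neg]; linarith)
    have h2 : e + D = e * (1 - -(f * D)) := by
      rw [sub_neg_eq_add, mul_add, mul_one, ← mul_assoc, hef, one_mul]
    rw [h2]; exact hEaunit.mul h1
  refine ⟨hunit, ?_⟩
  set g := Ring.inverse (e + D) with hg
  have hg1 : (e + D) * g = 1 := Ring.mul_inverse_cancel _ hunit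
  have hg2 : g = f - f * D * g := by
    have := congrArg (f * ·) hg1
    simp only [mul_one, ← mul_assoc, mul_add, hfe, add_mul, one_mul] at this
    exact eq_sub_of_add_eq this
  have hg3 : ‖g‖ ≤ 1 / αs + κ / 2 * ‖g‖ := by
    calc ‖g‖ = ‖f - f * D * g‖ := by rw [← hg2]
      _ ≤ ‖f‖ + ‖f * D * g‖ := norm_sub_le _ _
      _ ≤ ‖f‖ + ‖f * D‖ * ‖g‖ := by gcongr; exact norm_mul_le _ _
      _ ≤ _ := by gcongr
  rw [le_div_iff₀ (by nlinarith)]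
  have : αs * ‖g‖ ≤ αs * (1 / αs + κ / 2 * ‖g‖) := mul_le_mul_of_nonneg_left hg3 hαs.le
  rw [mul_add, mul_one_div_cancel hαs.ne'] at this
  linarith
end
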